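/- (D'Ambrosio's Hardy-type inequality on the Heisenberg group.) Let d ≥ 2. For every f ∈ 𝒮(ℝ^{2d+1}), ∫_{ℝ^{2d+1}} |z|^{−2} |f(z,t)|² dz dt ≤ (d−1)^{−2} ∫_{ℝ^{2d+1}} |∇_H f(z,t)|² dz dt. -/

import Mathlib

noncomputable section

open MeasureTheory ENNReal

/-- The Heisenberg group ℍ^d modeled on ℝ^d × ℝ^d × ℝ. -/
abbrev Hd (d : ℕ) : Type := EuclideanSpace ℝ (Fin d) × EuclideanSpace ℝ (Fin d) × ℝ

/-- The left-invariant vector field `X_j = ∂_{x_j} + 2 y_j ∂_t`. -/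
def Xop (d : ℕ) (j : Fin d) (f : Hd d → ℂ) (p : Hd d) : ℂ :=
  fderiv ℝ f p (EuclideanSpace.single j 1, 0, 2 * p.2.1 j)

/-- The left-invariant vector field `Y_j = ∂_{y_j} - 2 x_j ∂_t`. -/
def Yop (d : ℕ) (j : Fin d) (f : Hd d → ℂ) (p : Hd d) : ℂ :=
  fderiv ℝ f p (0, EuclideanSpace.single j 1, -(2 * p.1 j))

/-- The vertical derivative `T = ∂_t`. -/
def Tder (d : ℕ) (f : Hd d → ℂ) (p : Hd d) : ℂ :=
  fderiv ℝ f p (0, 0, 1)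

/-- The rotation operator `N = Σ_j (y_j ∂_{x_j} - x_j ∂_{y_j})`. -/
def Nop (d : ℕ) (f : Hd d → ℂ) (p : Hd d) : ℂ :=
  fderiv ℝ f p (p.2.1, -p.1, 0)

/-- The sublaplacian `Δ_H = Σ_j (X_j² + Y_j²)`. -/
def subLap (d : ℕ) (f : Hd d → ℂ) (p : Hd d) : ℂ :=
  ∑ j : Fin d, (Xop d j (Xop d j f) p + Yop d j (Yop d j f) p)

/-- Squared length of the horizontal gradient: `|∇_H f|² = Σ_j (|X_j f|² + |Y_j f|²)`. -/
def gradHsq (d : ℕ) (f : Hd d → ℂ) (p : Hd d) : ℝ :=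
  ∑ j : Fin d, (‖Xop d j f p‖ ^ 2 + ‖Yop d j f p‖ ^ 2)

/-- `|z|² = |x|² + |y|²`. -/
def zsq (d : ℕ) (p : Hd d) : ℝ := ‖p.1‖ ^ 2 + ‖p.2.1‖ ^ 2

/-- `|z|`. -/
def zn (d : ℕ) (p : Hd d) : ℝ := Real.sqrt (zsq d p)

/-- The weight `w₁(z,t) = |z| (1+|z|²)^{-1/2} (1 + (|z|⁴+t²)^{1/2})⁻¹`. -/
def w1 (d : ℕ) (p : Hd d) : ℝ :=
  zn d p / Real.sqrt (1 + zn d p ^ 2) / (1 + Real.sqrt (zn d p ^ 4 + p.2.2 ^ 2))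

/-- The weight `w₂(z,t) = (1+|z|²+t²)^{-1/2}`. -/
def w2 (d : ℕ) (p : Hd d) : ℝ :=
  (Real.sqrt (1 + zsq d p + p.2.2 ^ 2))⁻¹

/-- The weight `w₄(z,t) = |z| (|z|⁴+t²)^{-1/2}`. -/
def w4 (d : ℕ) (p : Hd d) : ℝ :=
  zn d p / Real.sqrt (zn d p ^ 4 + p.2.2 ^ 2)

open SchwartzMap in
/-- Integration by parts of `w * |f|²` in the direction `v`, for a bounded weight `w` with bounded
directional derivative `w'`. -/
theorem integrable_and_integral_eq_zero_of_weight {E : Type*} [NormedAddCommGroup E]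
    [NormedSpace ℝ E] [FiniteDimensional ℝ E] [MeasurableSpace E] [BorelSpace E]
    (μ : Measure E) [μ.IsAddHaarMeasure] {w w' : E → ℝ} {v : E} {C C' : ℝ}
    (hw : ∀ p, HasLineDerivAt ℝ w (w' p) p v) (hwc : Continuous w) (hwc' : Continuous w')
    (hC : ∀ p, ‖w p‖ ≤ C) (hC' : ∀ p, ‖w' p‖ ≤ C') (f : 𝓢(E, ℂ)) :
    Integrable (fun p ↦ w' p * ‖f p‖ ^ 2 + w p * (2 * inner ℝ (f p) (fderiv ℝ f p v))) μ ∧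
      ∫ p, (w' p * ‖f p‖ ^ 2 + w p * (2 * inner ℝ (f p) (fderiv ℝ f p v))) ∂μ = 0 := by
  have hf2 : MemLp f 2 μ := f.memLp 2 μ
  have hDf2 : MemLp (fun p ↦ fderiv ℝ f p v) 2 μ :=
    (LineDeriv.lineDerivOp v f : 𝓢(E, ℂ)).memLp 2 μ
  have hsq : Integrable (fun p ↦ ‖f p‖ ^ 2) μ := hf2.integrable_norm_pow two_ne_zero
  have hin : Integrable (fun p ↦ 2 * inner ℝ (f p) (fderiv ℝ f p v)) μ :=
    ((hf2.norm.integrable_mul hDf2.norm).mono' (hf2.1.inner hDf2.1)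
      (.of_forall fun p ↦ norm_inner_le_norm _ _)).const_mul 2
  have h1 : Integrable (fun p ↦ w' p * ‖f p‖ ^ 2) μ :=
    hsq.bdd_mul hwc'.aestronglyMeasurable (.of_forall hC')
  have h2 : Integrable (fun p ↦ w p * (2 * inner ℝ (f p) (fderiv ℝ f p v))) μ :=
    hin.bdd_mul hwc.aestronglyMeasurable (.of_forall hC)
  have h3 : Integrable (fun p ↦ w p * ‖f p‖ ^ 2) μ :=
    hsq.bdd_mul hwc.aestronglyMeasurable (.of_forall hC)
  refine ⟨h1.add h2, ?_⟩
  have hderiv (p : E) : HasLineDerivAt ℝ (fun p ↦ ‖f p‖ ^ 2)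
      (2 * inner ℝ (f p) (fderiv ℝ f p v)) p v := by
    have h := ((f.differentiable p).hasFDerivAt.hasLineDerivAt v)
    simpa only [HasLineDerivAt, zero_smul, add_zero] using HasDerivAt.norm_sq h
  have key := integral_bilinear_hasLineDerivAt_right_eq_neg_left_of_integrable
    (B := ContinuousLinearMap.mul ℝ ℝ) (f := w) (f' := w') (v := v) (μ := μ)
    (g := fun p ↦ ‖f p‖ ^ 2) (g' := fun p ↦ 2 * inner ℝ (f p) (fderiv ℝ f p v))
    h1 h2 h3 (fun p _ ↦ hw p) (fun p _ ↦ hderiv p)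
  simp only [ContinuousLinearMap.mul_apply'] at key
  rw [integral_add h1 h2, key, add_neg_cancel]

/-- The case of the weight `ℓ / (q + ε)`, where `ℓ` and `q` behave in the direction `v` like a
coordinate and the squared Euclidean norm. -/
theorem integrable_and_integral_eq_zero_of_coordinate {E : Type*} [NormedAddCommGroup E]
    [NormedSpace ℝ E] [FiniteDimensional ℝ E] [MeasurableSpace E] [BorelSpace E]
    (μ : Measure E) [μ.IsAddHaarMeasure] {l q : E → ℝ} {v : E} {ε : ℝ} (hε : 0 < ε)
    (hlc : Continuous l) (hqc : Continuous q) (hlq : ∀ p, l p ^ 2 ≤ q p)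
    (hl : ∀ p (t : ℝ), l (p + t • v) = l p + t)
    (hq : ∀ p (t : ℝ), q (p + t • v) = q p + 2 * t * l p + t ^ 2) (f : SchwartzMap E ℂ) :
    Integrable (fun p ↦ ((q p + ε)⁻¹ - 2 * l p ^ 2 * (q p + ε)⁻¹ ^ 2) * ‖f p‖ ^ 2 +
        l p * (q p + ε)⁻¹ * (2 * inner ℝ (f p) (fderiv ℝ f p v))) μ ∧
      ∫ p, (((q p + ε)⁻¹ - 2 * l p ^ 2 * (q p + ε)⁻¹ ^ 2) * ‖f p‖ ^ 2 +
        l p * (q p + ε)⁻¹ * (2 * inner ℝ (f p) (fderiv ℝ f p v))) ∂μ = 0 := by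
  have hpos (p : E) : 0 < q p + ε := by nlinarith [hlq p, sq_nonneg (l p)]
  have hinv (p : E) : (q p + ε)⁻¹ ≤ ε⁻¹ := by
    gcongr
    nlinarith [hlq p, sq_nonneg (l p)]
  have hsq (p : E) : l p ^ 2 * (q p + ε)⁻¹ ≤ 1 := by
    rw [← div_eq_mul_inv, div_le_one (hpos p)]
    linarith [hlq p]
  have hic : Continuous fun p ↦ (q p + ε)⁻¹ := (hqc.add_const ε).inv₀ fun p ↦ (hpos p).ne'
  refine integrable_and_integral_eq_zero_of_weight μ (w := fun p ↦ l p * (q p + ε)⁻¹)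
    (C := 1 + ε⁻¹) (C' := ε⁻¹ + 2 * ε⁻¹)
    ?_ (hlc.mul hic) (by fun_prop) ?_ ?_ f
  · intro p
    have hl' : HasDerivAt (fun t : ℝ ↦ l (p + t • v)) 1 0 := by
      simp only [hl]
      exact (hasDerivAt_id' 0).const_add _
    have hq' : HasDerivAt (fun t : ℝ ↦ q (p + t • v) + ε) (2 * l p) 0 := by
      simp only [hq]
      have h := ((((hasDerivAt_id' (0 : ℝ)).const_mul 2).mul_const (l p)).const_add (q p)).add
        ((hasDerivAt_id' (0 : ℝ)).pow 2)
      convert! h.add_const ε using 1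
      simp
    have h := hl'.mul (hq'.inv (by simpa using (hpos p).ne'))
    refine HasDerivAt.congr_deriv h ?_
    have := (hpos p).ne'
    simp only [zero_smul, add_zero, Pi.inv_apply]
    field_simp
    ring
  · intro p
    have h1 : |l p| ≤ l p ^ 2 + 1 := by
      rw [abs_le]; constructor <;> nlinarith [sq_nonneg (l p + 1), sq_nonneg (l p - 1)]
    have h0 := inv_pos.2 (hpos p)
    rw [norm_mul, Real.norm_eq_abs, Real.norm_eq_abs, abs_of_pos h0]
    nlinarith [hsq p, hinv p, mul_le_mul_of_nonneg_right h1 h0.le]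
  · intro p
    have h0 := inv_pos.2 (hpos p)
    have h1 := mul_le_mul_of_nonneg_right (hsq p) h0.le
    have h2 := mul_nonneg (mul_nonneg (sq_nonneg (l p)) h0.le) h0.le
    have := hinv p
    rw [Real.norm_eq_abs, abs_le]
    constructor <;> nlinarith

theorem continuous_zsq (d : ℕ) : Continuous (zsq d) := by
  unfold zsq; fun_prop

theorem zsq_eq_sum (d : ℕ) (p : Hd d) :
    zsq d p = ∑ j : Fin d, (p.1 j ^ 2 + p.2.1 j ^ 2) := by
  simp [zsq, EuclideanSpace.norm_sq_eq, Finset.sum_add_distrib]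

theorem zsq_nonneg (d : ℕ) (p : Hd d) : 0 ≤ zsq d p := by
  unfold zsq; positivity

theorem sq_coordinates_le_zsq (d : ℕ) (p : Hd d) (j : Fin d) :
    p.1 j ^ 2 + p.2.1 j ^ 2 ≤ zsq d p := by
  rw [zsq_eq_sum]
  exact Finset.single_le_sum (f := fun j ↦ p.1 j ^ 2 + p.2.1 j ^ 2)
    (fun i _ ↦ by positivity) (Finset.mem_univ j)

theorem norm_add_smul_single_sq {d : ℕ} (x : EuclideanSpace ℝ (Fin d)) (j : Fin d) (t : ℝ) :
    ‖x + t • EuclideanSpace.single j (1 : ℝ)‖ ^ 2 = ‖x‖ ^ 2 + 2 * t * x j + t ^ 2 := by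
  rw [norm_add_sq_real, inner_smul_right, EuclideanSpace.inner_single_right, norm_smul]
  simp
  ring

theorem continuous_gradHsq (d : ℕ) (f : SchwartzMap (Hd d) ℂ) : Continuous (gradHsq d f) := by
  have h : Continuous (fderiv ℝ f) := (f.smooth 1).continuous_fderiv one_ne_zero
  unfold gradHsq Xop Yop
  fun_prop

theorem gradHsq_nonneg (d : ℕ) (f : Hd d → ℂ) (p : Hd d) : 0 ≤ gradHsq d f p := by
  unfold gradHsq; positivity

/-- The vertical parts of `x_j X_j` and `y_j Y_j` cancel. -/
theorem smul_Xop_add_smul_Yop (d : ℕ) (j : Fin d) (f : Hd d → ℂ) (p : Hd d) :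
    p.1 j • Xop d j f p + p.2.1 j • Yop d j f p =
      p.1 j • fderiv ℝ f p (EuclideanSpace.single j 1, 0, 0) +
        p.2.1 j • fderiv ℝ f p (0, EuclideanSpace.single j 1, 0) := by
  unfold Xop Yop
  simp only [← map_smul, ← map_add]
  congr 1
  ext <;> simp
  ring

/-- Completing the square, in a real inner product space. -/
theorem neg_sq_sub_le_inner {F : Type*} [NormedAddCommGroup F] [InnerProductSpace ℝ F]
    (u v : F) {c : ℝ} (hc : 0 < c) (a : ℝ) :
    -(c⁻¹ * ‖v‖ ^ 2) - c * a ^ 2 * ‖u‖ ^ 2 ≤ 2 * (a * inner ℝ u v) := by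
  have h := sq_nonneg ‖v + (c * a) • u‖
  rw [norm_add_sq_real, inner_smul_right, norm_smul, mul_pow, Real.norm_eq_abs, sq_abs,
    real_inner_comm] at h
  have h' := mul_nonneg (inv_pos.2 hc).le h
  have e : c⁻¹ * (‖v‖ ^ 2 + 2 * (c * a * inner ℝ u v) + (c * a) ^ 2 * ‖u‖ ^ 2) =
      c⁻¹ * ‖v‖ ^ 2 + 2 * (a * inner ℝ u v) + c * a ^ 2 * ‖u‖ ^ 2 := by
    field_simp
  linarith

/-- The divergence of `|f|² z / (|z|² + ε)` dominates the difference of the two sides of the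
regularised Hardy inequality. -/
theorem regularized_hardy_pointwise (d : ℕ) (hd : 2 ≤ d) (f : Hd d → ℂ) (p : Hd d) {ε : ℝ}
    (hε : 0 < ε) :
    ((d : ℝ) - 1) * ((zsq d p + ε)⁻¹ * ‖f p‖ ^ 2) - ((d : ℝ) - 1)⁻¹ * gradHsq d f p ≤
      ∑ j : Fin d,
        ((((zsq d p + ε)⁻¹ - 2 * p.1 j ^ 2 * (zsq d p + ε)⁻¹ ^ 2) * ‖f p‖ ^ 2 +
          p.1 j * (zsq d p + ε)⁻¹ *
            (2 * inner ℝ (f p) (fderiv ℝ f p (EuclideanSpace.single j 1, 0, 0)))) +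
        (((zsq d p + ε)⁻¹ - 2 * p.2.1 j ^ 2 * (zsq d p + ε)⁻¹ ^ 2) * ‖f p‖ ^ 2 +
          p.2.1 j * (zsq d p + ε)⁻¹ *
            (2 * inner ℝ (f p) (fderiv ℝ f p (0, EuclideanSpace.single j 1, 0))))) := by
  have hd' : (2 : ℝ) ≤ d := by exact_mod_cast hd
  set c : ℝ := (d : ℝ) - 1 with hcdef
  have hc : 0 < c := by linarith
  have hpos : 0 < zsq d p + ε := by linarith [zsq_nonneg d p]
  set φ : ℝ := (zsq d p + ε)⁻¹ with hφ
  have hφ0 : 0 < φ := inv_pos.2 hpos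
  have hzφ : zsq d p * φ ≤ 1 := by
    rw [hφ, ← div_eq_mul_inv, div_le_one hpos]
    linarith
  have hterm (j : Fin d) :
      2 * φ * ‖f p‖ ^ 2 - (2 + c) * φ ^ 2 * ‖f p‖ ^ 2 * (p.1 j ^ 2 + p.2.1 j ^ 2) -
        c⁻¹ * (‖Xop d j f p‖ ^ 2 + ‖Yop d j f p‖ ^ 2) ≤
        (((φ - 2 * p.1 j ^ 2 * φ ^ 2) * ‖f p‖ ^ 2 +
          p.1 j * φ *
            (2 * inner ℝ (f p) (fderiv ℝ f p (EuclideanSpace.single j 1, 0, 0)))) +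
        ((φ - 2 * p.2.1 j ^ 2 * φ ^ 2) * ‖f p‖ ^ 2 +
          p.2.1 j * φ *
            (2 * inner ℝ (f p) (fderiv ℝ f p (0, EuclideanSpace.single j 1, 0))))) := by
    have hX := neg_sq_sub_le_inner (f p) (Xop d j f p) hc (p.1 j * φ)
    have hY := neg_sq_sub_le_inner (f p) (Yop d j f p) hc (p.2.1 j * φ)
    have h := congrArg (fun v ↦ φ * inner ℝ (f p) v) (smul_Xop_add_smul_Yop d j f p)
    simp only [inner_add_right, inner_smul_right] at h
    linarith
  refine le_trans ?_ (Finset.sum_le_sum fun j _ ↦ hterm j)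
  simp only [Finset.sum_sub_distrib, ← Finset.mul_sum, ← zsq_eq_sum, Finset.sum_const,
    Finset.card_univ, Fintype.card_fin, nsmul_eq_mul]
  have hF : 0 ≤ (2 + c) * φ * ‖f p‖ ^ 2 := by positivity
  have h := mul_le_mul_of_nonneg_left hzφ hF
  have hdc : (d : ℝ) = c + 1 := by linarith
  rw [hdc]
  unfold gradHsq
  linarith

/-- Hardy's inequality with the regularised weight `(|z|² + ε)⁻¹`. -/
theorem regularized_hardy (d : ℕ) (hd : 2 ≤ d) (f : SchwartzMap (Hd d) ℂ) {ε : ℝ}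
    (hε : 0 < ε) :
    ∫⁻ p, ENNReal.ofReal ((zsq d p + ε)⁻¹ * ‖f p‖ ^ 2) ≤
      ENNReal.ofReal ((((d : ℝ) - 1)⁻¹) ^ 2) * ∫⁻ p, ENNReal.ofReal (gradHsq d (⇑f) p) := by
  have hd' : (2 : ℝ) ≤ d := by exact_mod_cast hd
  have hc : 0 < (d : ℝ) - 1 := by linarith
  by_cases htop : ∫⁻ p, ENNReal.ofReal (gradHsq d (⇑f) p) = ∞
  · rw [htop, ENNReal.mul_top (by simpa using hc.ne')]
    exact le_top
  have hG : Integrable (gradHsq d f) := by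
    refine (lintegral_ofReal_ne_top_iff_integrable
      (continuous_gradHsq d f).aestronglyMeasurable (.of_forall (gradHsq_nonneg d f))).1 htop
  have : (volume : Measure (EuclideanSpace ℝ (Fin d) × ℝ)).IsAddHaarMeasure :=
    Measure.prod.instIsAddHaarMeasure volume volume
  have : (volume : Measure (Hd d)).IsAddHaarMeasure :=
    Measure.prod.instIsAddHaarMeasure volume volume
  have hx (j : Fin d) := integrable_and_integral_eq_zero_of_coordinate
    (volume : Measure (Hd d)) (l := fun p ↦ p.1 j) (q := zsq d)
    (v := (EuclideanSpace.single j 1, 0, 0)) hε (by fun_prop) (continuous_zsq d)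
    (fun p ↦ by nlinarith [sq_coordinates_le_zsq d p j, sq_nonneg (p.2.1 j)])
    (fun p t ↦ by simp)
    (fun p t ↦ by
      simp only [zsq, Prod.fst_add, Prod.snd_add, Prod.smul_fst, Prod.smul_snd,
        norm_add_smul_single_sq, smul_zero, add_zero]
      ring) f
  have hy (j : Fin d) := integrable_and_integral_eq_zero_of_coordinate
    (volume : Measure (Hd d)) (l := fun p ↦ p.2.1 j) (q := zsq d)
    (v := (0, EuclideanSpace.single j 1, 0)) hε (by fun_prop) (continuous_zsq d)
    (fun p ↦ by nlinarith [sq_coordinates_le_zsq d p j, sq_nonneg (p.1 j)])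
    (fun p t ↦ by simp)
    (fun p t ↦ by
      simp only [zsq, Prod.fst_add, Prod.snd_add, Prod.smul_fst, Prod.smul_snd,
        norm_add_smul_single_sq, smul_zero, add_zero]
      ring) f
  have hφc : Continuous fun p ↦ (zsq d p + ε)⁻¹ :=
    ((continuous_zsq d).add_const ε).inv₀ fun p ↦ by linarith [zsq_nonneg d p]
  have hφ (p : Hd d) : 0 ≤ (zsq d p + ε)⁻¹ := inv_nonneg.2 (by linarith [zsq_nonneg d p])
  have hL : Integrable fun p ↦ (zsq d p + ε)⁻¹ * ‖f p‖ ^ 2 := by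
    refine ((f.memLp 2 volume).integrable_norm_pow two_ne_zero).bdd_mul (c := ε⁻¹)
      hφc.aestronglyMeasurable (.of_forall fun p ↦ ?_)
    rw [Real.norm_of_nonneg (hφ p)]
    gcongr
    linarith [zsq_nonneg d p]
  have hint := integral_mono ((hL.const_mul ((d : ℝ) - 1)).sub (hG.const_mul ((d : ℝ) - 1)⁻¹))
    (integrable_finsetSum Finset.univ fun j _ ↦ (hx j).1.add (hy j).1)
    (fun p ↦ by simpa using regularized_hardy_pointwise d hd f p hε)
  rw [integral_finsetSum _ fun j _ ↦ (hx j).1.add (hy j).1] at hint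
  simp only [Pi.sub_apply, Pi.add_apply] at hint
  rw [integral_sub (hL.const_mul _) (hG.const_mul _), integral_const_mul,
    integral_const_mul, Finset.sum_eq_zero fun j _ ↦ by
      rw [integral_add (hx j).1 (hy j).1, (hx j).2, (hy j).2, add_zero]] at hint
  rw [← ofReal_integral_eq_lintegral_ofReal hL
      (.of_forall fun p ↦ mul_nonneg (hφ p) (sq_nonneg _)),
    ← ofReal_integral_eq_lintegral_ofReal hG (.of_forall (gradHsq_nonneg d f)),
    ← ENNReal.ofReal_mul (sq_nonneg _)]
  refine ENNReal.ofReal_le_ofReal ?_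
  have h := mul_le_mul_of_nonneg_left (sub_nonpos.1 hint) (inv_pos.2 hc).le
  rw [inv_mul_cancel_left₀ hc.ne'] at h
  rwa [sq, mul_assoc]

/-- D'Ambrosio's Hardy-type inequality on the Heisenberg group:
`∫ |z|⁻² |f|² ≤ (d-1)⁻² ∫ |∇_H f|²` for Schwartz `f`, `d ≥ 2`. -/
theorem hardy_dambrosio (d : ℕ) (hd : 2 ≤ d) (f : SchwartzMap (Hd d) ℂ) :
    ∫⁻ p, ENNReal.ofReal ((zsq d p)⁻¹ * ‖f p‖ ^ 2) ≤
      ENNReal.ofReal ((((d : ℝ) - 1)⁻¹) ^ 2) * ∫⁻ p, ENNReal.ofReal (gradHsq d (⇑f) p) := by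
  have hlim (p : Hd d) : ENNReal.ofReal ((zsq d p)⁻¹ * ‖f p‖ ^ 2) ≤ Filter.liminf
      (fun n : ℕ ↦ ENNReal.ofReal ((zsq d p + 1 / ((n : ℝ) + 1))⁻¹ * ‖f p‖ ^ 2))
      Filter.atTop := by
    by_cases hp : zsq d p = 0
    · simp [hp]
    · refine (Filter.Tendsto.liminf_eq (ENNReal.tendsto_ofReal ?_)).ge
      have h := (tendsto_one_div_add_atTop_nhds_zero_nat (𝕜 := ℝ)).const_add (zsq d p)
      rw [add_zero] at h
      exact (h.inv₀ hp).mul_const _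
  have hmeas (n : ℕ) : Measurable fun p : Hd d ↦
      ENNReal.ofReal ((zsq d p + 1 / ((n : ℝ) + 1))⁻¹ * ‖f p‖ ^ 2) :=
    (((continuous_zsq d).measurable.add_const _).inv.mul
      (f.continuous.norm.pow 2).measurable).ennreal_ofReal
  refine (lintegral_mono hlim).trans ((lintegral_liminf_le hmeas).trans ?_)
  exact Filter.liminf_le_of_frequently_le'
    (Filter.Frequently.of_forall fun n ↦ regularized_hardy d hd f Nat.one_div_pos_of_nat)
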